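/- If S is a semigroup and R is an epsilon-strongly S-graded ring, then the subring R_e is a unital ring for every idempotent e ∈ E(S). -/

import Mathlib

open scoped Pointwise

/-- The set `E(S)` of idempotent elements of a semigroup `S`. -/
def idempotentSet (S : Type*) [Semigroup S] : Set S := {s | s * s = s}

/-- The set `V(s) = {t ∈ S ∣ sts = s and tst = t}`. -/
def invSet {S : Type*} [Semigroup S] (s : S) : Set S :=
  {t | s * t * s = s ∧ t * s * t = t}

/-- The product `A B` of two additive subgroups of a ring: the additive subgroup
generated by all products `a * b` with `a ∈ A`, `b ∈ B`. -/
def subgroupMul {R : Type*} [NonUnitalRing R] (A B : AddSubgroup R) : AddSubgroup R :=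
  AddSubgroup.closure ((A : Set R) * (B : Set R))

/-- `R` is an `S`-graded ring via the family `𝒜` of additive subgroups:
`R = ⊕_{s ∈ S} R_s` (internal direct sum) and `R_s R_t ⊆ R_{st}`. -/
structure IsSemigroupGrading {S R : Type*} [Semigroup S] [DecidableEq S] [NonUnitalRing R]
    (𝒜 : S → AddSubgroup R) : Prop where
  internal : DirectSum.IsInternal 𝒜
  mul_mem : ∀ s t : S, ∀ a ∈ 𝒜 s, ∀ b ∈ 𝒜 t, a * b ∈ 𝒜 (s * t)

/-- `R` is symmetrically `S`-graded: `R_s = R_s R_t R_s` for all `s ∈ S`, `t ∈ V(s)`. -/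
def SymmetricallyGraded {S R : Type*} [Semigroup S] [NonUnitalRing R]
    (𝒜 : S → AddSubgroup R) : Prop :=
  ∀ s : S, ∀ t ∈ invSet s, 𝒜 s = subgroupMul (subgroupMul (𝒜 s) (𝒜 t)) (𝒜 s)

/-- A subset `P` of `R` (closed under multiplication) is a unital ring:
it has a two-sided multiplicative identity element. -/
def HasUnity {R : Type*} [NonUnitalRing R] (P : AddSubgroup R) : Prop :=
  ∃ u ∈ P, ∀ x ∈ P, u * x = x ∧ x * u = x

/-- A subset `P` of `R` is an s-unital ring: `x ∈ Px` and `x ∈ xP` for every `x ∈ P`. -/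
def IsSUnital {R : Type*} [NonUnitalRing R] (P : AddSubgroup R) : Prop :=
  ∀ x ∈ P, (∃ u ∈ P, u * x = x) ∧ (∃ v ∈ P, x * v = x)

/-- A subset `P` of `R` is a von Neumann regular ring: `r ∈ rPr` for every `r ∈ P`. -/
def IsVonNeumannRegular {R : Type*} [NonUnitalRing R] (P : AddSubgroup R) : Prop :=
  ∀ r ∈ P, ∃ x ∈ P, r = r * x * r

/-- `R` is epsilon-strongly `S`-graded. -/
def EpsilonStronglyGraded {S R : Type*} [Semigroup S] [NonUnitalRing R]
    (𝒜 : S → AddSubgroup R) : Prop :=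
  SymmetricallyGraded 𝒜 ∧ ∀ s : S, ∀ t ∈ invSet s, HasUnity (subgroupMul (𝒜 s) (𝒜 t))

/-- `R` is nearly epsilon-strongly `S`-graded. -/
def NearlyEpsilonStronglyGraded {S R : Type*} [Semigroup S] [NonUnitalRing R]
    (𝒜 : S → AddSubgroup R) : Prop :=
  SymmetricallyGraded 𝒜 ∧ ∀ s : S, ∀ t ∈ invSet s, IsSUnital (subgroupMul (𝒜 s) (𝒜 t))

/-- `R` is strongly `S`-graded: `R_s R_t = R_{st}` for all `s, t ∈ S`. -/
def StronglyGraded {S R : Type*} [Semigroup S] [NonUnitalRing R]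
    (𝒜 : S → AddSubgroup R) : Prop :=
  ∀ s t : S, subgroupMul (𝒜 s) (𝒜 t) = 𝒜 (s * t)

/-- `R` is graded von Neumann regular: for all `s ∈ S`, `r ∈ R_s` and `t ∈ V(s)`,
there is `y ∈ R_t` with `r = ryr`. -/
def GradedVonNeumannRegular {S R : Type*} [Semigroup S] [NonUnitalRing R]
    (𝒜 : S → AddSubgroup R) : Prop :=
  ∀ s : S, ∀ r ∈ 𝒜 s, ∀ t ∈ invSet s, ∃ y ∈ 𝒜 t, r = r * y * r

theorem subgroupMul_le {R : Type*} [NonUnitalRing R] {A B C : AddSubgroup R}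
    (h : ∀ a ∈ A, ∀ b ∈ B, a * b ∈ C) : subgroupMul A B ≤ C := by
  refine (AddSubgroup.closure_le C).2 ?_
  rintro _ ⟨a, ha, b, hb, rfl⟩
  exact h a ha b hb

theorem mul_mem_subgroupMul {R : Type*} [NonUnitalRing R] {A B : AddSubgroup R} {a b : R}
    (ha : a ∈ A) (hb : b ∈ B) : a * b ∈ subgroupMul A B :=
  AddSubgroup.subset_closure (Set.mul_mem_mul ha hb)

/-- An idempotent component of a symmetrically graded ring is an idempotent ring. -/
theorem subgroupMul_self_of_mem_idempotentSet {S R : Type*} [Semigroup S] [DecidableEq S]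
    [NonUnitalRing R] {𝒜 : S → AddSubgroup R} (hgr : IsSemigroupGrading 𝒜)
    (hsym : SymmetricallyGraded 𝒜) {e : S} (he : e * e = e) :
    subgroupMul (𝒜 e) (𝒜 e) = 𝒜 e := by
  have hle : subgroupMul (𝒜 e) (𝒜 e) ≤ 𝒜 e :=
    subgroupMul_le fun a ha b hb => by simpa only [he] using hgr.mul_mem e e a ha b hb
  refine le_antisymm hle ?_
  calc 𝒜 e = subgroupMul (subgroupMul (𝒜 e) (𝒜 e)) (𝒜 e) :=
        hsym e e ⟨by rw [he, he], by rw [he, he]⟩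
    _ ≤ subgroupMul (𝒜 e) (𝒜 e) :=
        subgroupMul_le fun a ha b hb => mul_mem_subgroupMul (hle ha) hb

/-- **Corollary.** If `R` is an epsilon-strongly `S`-graded ring, then `R_e` is a unital
ring for every idempotent `e ∈ E(S)`. -/
theorem unital_component_of_epsilonStronglyGraded
    {S R : Type*} [Semigroup S] [DecidableEq S] [NonUnitalRing R]
    (𝒜 : S → AddSubgroup R) (hgr : IsSemigroupGrading 𝒜)
    (heps : EpsilonStronglyGraded 𝒜) :
    ∀ e ∈ idempotentSet S, HasUnity (𝒜 e) := by
  intro e (he : e * e = e)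
  rw [← subgroupMul_self_of_mem_idempotentSet hgr heps.1 he]
  exact heps.2 e e ⟨by rw [he, he], by rw [he, he]⟩
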